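/- Let W be a finite-dimensional real vector space. For an odd superderivation D of ΛW define p_D ∈ W* by p_D(w) = ε(D(ι w)). Let V be a real vector space and let v ↦ D_v be a linear map from V into the space of odd superderivations of ΛW such that: (1) the map v ↦ p_{D_v} from V to W* is injective, and (2) D_v ∘ D_{v'} + D_{v'} ∘ D_v = 0 for all v, v' ∈ V. Then there exists a unital ℝ-algebra automorphism G of ΛW with G(Λ₊W) = Λ₊W and G(Λ₋W) = Λ₋W, such that G(ι w) − ι w ∈ (ker ε)² for every w ∈ W, and D_v(G(σ)) = G(ι_{p_{D_v}}(σ)) for all v ∈ V and all σ ∈ ΛW. -/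

import Mathlib

/-- The degree-`k` homogeneous component `Λᵏ W` of the exterior algebra. -/
noncomputable def piece (W : Type*) [AddCommGroup W] [Module ℝ W] (k : ℕ) :
    Submodule ℝ (ExteriorAlgebra ℝ W) :=
  (LinearMap.range (ExteriorAlgebra.ι ℝ : W →ₗ[ℝ] ExteriorAlgebra ℝ W)) ^ k

/-- The even part `Λ₊W`. -/
noncomputable def evenPart (W : Type*) [AddCommGroup W] [Module ℝ W] :
    Submodule ℝ (ExteriorAlgebra ℝ W) :=
  ⨆ k : ℕ, piece W (2 * k)

/-- The odd part `Λ₋W`. -/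
noncomputable def oddPart (W : Type*) [AddCommGroup W] [Module ℝ W] :
    Submodule ℝ (ExteriorAlgebra ℝ W) :=
  ⨆ k : ℕ, piece W (2 * k + 1)

namespace Stmt6Aux

open ExteriorAlgebra

variable {W : Type*} [AddCommGroup W] [Module ℝ W]

/-- The grading involution. -/
noncomputable def tau (W : Type*) [AddCommGroup W] [Module ℝ W] :
    ExteriorAlgebra ℝ W →ₐ[ℝ] ExteriorAlgebra ℝ W :=
  ExteriorAlgebra.lift ℝ ⟨-(ExteriorAlgebra.ι ℝ), fun m => by simp⟩

lemma tau_ι (w : W) : tau W (ι ℝ w) = -ι ℝ w := by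
  simp [tau]

lemma tau_tau (x : ExteriorAlgebra ℝ W) : tau W (tau W x) = x := by
  have : (tau W).comp (tau W) = AlgHom.id ℝ _ := by
    apply ExteriorAlgebra.hom_ext
    ext w
    simp [tau_ι]
  exact DFunLike.congr_fun this x

lemma tau_piece (k : ℕ) (x : ExteriorAlgebra ℝ W) (hx : x ∈ piece W k) :
    tau W x = ((-1 : ℝ) ^ k) • x := by
  unfold piece at hx
  induction hx using Submodule.pow_induction_on_left' with
  | algebraMap r => simp
  | add x y i hx hy ihx ihy => rw [map_add, ihx, ihy, smul_add]
  | mem_mul m hm i x hx ih =>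
    obtain ⟨w, rfl⟩ := hm
    rw [map_mul, ih, tau_ι, pow_succ]
    simp

lemma tau_of_even {x : ExteriorAlgebra ℝ W} (hx : x ∈ evenPart W) : tau W x = x := by
  unfold evenPart at hx
  induction hx using Submodule.iSup_induction' with
  | mem i x hx => rw [tau_piece _ _ hx]; simp
  | zero => simp
  | add x y _ _ hx hy => rw [map_add, hx, hy]

lemma tau_of_odd {x : ExteriorAlgebra ℝ W} (hx : x ∈ oddPart W) : tau W x = -x := by
  unfold oddPart at hx
  induction hx using Submodule.iSup_induction' with
  | mem i x hx => rw [tau_piece _ _ hx]; simp [pow_succ]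
  | zero => simp
  | add x y _ _ hx hy => rw [map_add, hx, hy]; abel

lemma even_sup_odd : evenPart W ⊔ oddPart W = ⊤ := by
  rw [eq_top_iff, ← CliffordAlgebra.iSup_ι_range_eq_top (0 : QuadraticForm ℝ W)]
  refine iSup_le fun i => ?_
  rcases Nat.even_or_odd' i with ⟨c, rfl | rfl⟩
  · exact le_sup_of_le_left (le_iSup (fun k => piece W (2 * k)) c)
  · exact le_sup_of_le_right (le_iSup (fun k => piece W (2 * k + 1)) c)

lemma self_eq_neg' {x : ExteriorAlgebra ℝ W} (h : x = -x) : x = 0 := by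
  have h2 : (2 : ℝ) • x = 0 := by
    rw [two_smul]; nth_rewrite 2 [h]; simp
  exact (smul_eq_zero.mp h2).resolve_left two_ne_zero

lemma mem_even_iff {x : ExteriorAlgebra ℝ W} : x ∈ evenPart W ↔ tau W x = x := by
  refine ⟨tau_of_even, fun h => ?_⟩
  have hx : x ∈ evenPart W ⊔ oddPart W := by rw [even_sup_odd]; trivial
  obtain ⟨y, hy, z, hz, rfl⟩ := Submodule.mem_sup.mp hx
  rw [map_add, tau_of_even hy, tau_of_odd hz] at h
  have : z = 0 := self_eq_neg' (add_left_cancel h).symm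
  simpa [this] using hy

lemma mem_odd_iff {x : ExteriorAlgebra ℝ W} : x ∈ oddPart W ↔ tau W x = -x := by
  refine ⟨tau_of_odd, fun h => ?_⟩
  have hx : x ∈ evenPart W ⊔ oddPart W := by rw [even_sup_odd]; trivial
  obtain ⟨y, hy, z, hz, rfl⟩ := Submodule.mem_sup.mp hx
  rw [map_add, tau_of_even hy, tau_of_odd hz, neg_add] at h
  have : y = 0 := self_eq_neg' (add_right_cancel h)
  simpa [this] using hz

lemma ι_mul_comm (w : W) (a : ExteriorAlgebra ℝ W) : ι ℝ w * a = tau W a * ι ℝ w := by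
  induction a using ExteriorAlgebra.induction with
  | algebraMap r => rw [AlgHom.commutes]; exact (Algebra.commutes r _).symm
  | ι m => rw [tau_ι, neg_mul]; exact eq_neg_of_add_eq_zero_left (ι_add_mul_swap w m)
  | mul a b ha hb => rw [← mul_assoc, ha, mul_assoc, hb, map_mul, mul_assoc]
  | add a b ha hb => rw [mul_add, ha, hb, map_add, add_mul]

lemma piece_mul_comm (k : ℕ) (x : ExteriorAlgebra ℝ W) (hx : x ∈ piece W k) :
    ∀ a, x * a = (tau W)^[k] a * x := by
  unfold piece at hx
  induction hx using Submodule.pow_induction_on_left' with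
  | algebraMap r => intro a; exact Algebra.commutes r a
  | add x y i hx hy ihx ihy => intro a; rw [add_mul, ihx, ihy, mul_add]
  | mem_mul m hm i x hx ih =>
    intro a
    obtain ⟨w, rfl⟩ := hm
    rw [mul_assoc, ih, ← mul_assoc, ι_mul_comm, Function.iterate_succ_apply', mul_assoc]

lemma odd_mul_comm {x : ExteriorAlgebra ℝ W} (hx : x ∈ oddPart W) (a) :
    x * a = tau W a * x := by
  unfold oddPart at hx
  induction hx using Submodule.iSup_induction' with
  | mem i x hx =>
    rw [piece_mul_comm _ _ hx, Function.iterate_succ_apply,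
      (show Function.Involutive (tau W) from tau_tau).iterate_even (even_two_mul i)]
    rfl
  | zero => simp
  | add x y _ _ hx hy => rw [add_mul, mul_add, hx, hy]

lemma odd_sq {x : ExteriorAlgebra ℝ W} (hx : tau W x = -x) : x * x = 0 := by
  apply self_eq_neg'
  nth_rewrite 1 [odd_mul_comm (mem_odd_iff.mpr hx) x]
  rw [hx, neg_mul]

/-- Augmentation ideal as a real subspace. -/
noncomputable def K (ε : ExteriorAlgebra ℝ W →ₐ[ℝ] ℝ) : Submodule ℝ (ExteriorAlgebra ℝ W) :=
  LinearMap.ker ε.toLinearMap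

lemma mem_K {ε : ExteriorAlgebra ℝ W →ₐ[ℝ] ℝ} {x} : x ∈ K ε ↔ ε x = 0 := Iff.rfl

/-- The filtration by degree. -/
noncomputable def J (W : Type*) [AddCommGroup W] [Module ℝ W] (k : ℕ) :
    Submodule ℝ (ExteriorAlgebra ℝ W) := ⨆ i : ℕ, piece W (k + i)

lemma J_mul (a b : ℕ) : J W a * J W b ≤ J W (a + b) := by
  unfold J
  rw [Submodule.iSup_mul]
  refine iSup_le fun i => ?_
  rw [Submodule.mul_iSup]
  refine iSup_le fun j => ?_
  refine le_trans (le_of_eq ?_) (le_iSup (fun i => piece W (a + b + i)) (i + j))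
  unfold piece
  rw [← pow_add]
  congr 1
  omega

lemma J_pow (n : ℕ) : J W 1 ^ (n + 1) ≤ J W (n + 1) := by
  induction n with
  | zero => simp
  | succ n ih =>
    rw [pow_succ]
    exact (mul_le_mul' ih le_rfl).trans (J_mul _ _)

lemma piece_bot [FiniteDimensional ℝ W] (k : ℕ) (hk : Module.finrank ℝ W < k) :
    piece W k = ⊥ := by
  have := ExteriorAlgebra.ιMulti_span_fixedDegree ℝ (M := W) k
  unfold piece
  change ⋀[ℝ]^k W = ⊥
  rw [← this, Submodule.span_eq_bot]
  rintro _ ⟨v, rfl⟩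
  apply AlternatingMap.map_linearDependent
  intro h
  have := h.fintype_card_le_finrank
  simp at this
  omega

lemma sub_eps_mem_J (ε : ExteriorAlgebra ℝ W →ₐ[ℝ] ℝ) (hε : ∀ w : W, ε (ι ℝ w) = 0)
    (x : ExteriorAlgebra ℝ W) : x - algebraMap ℝ _ (ε x) ∈ J W 1 := by
  induction x using ExteriorAlgebra.induction with
  | algebraMap r => simp
  | ι w =>
    rw [hε, map_zero, sub_zero]
    refine Submodule.mem_iSup_of_mem 0 ?_
    simp [piece]
  | mul a b ha hb =>
    have h2 : (a - algebraMap ℝ _ (ε a)) * (b - algebraMap ℝ _ (ε b)) ∈ J W 1 := by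
      have := J_mul 1 1 (Submodule.mul_mem_mul ha hb)
      refine (iSup_le fun i => ?_ : J W (1 + 1) ≤ J W 1) this
      refine le_trans (le_of_eq ?_) (le_iSup (fun i => piece W (1 + i)) (1 + i))
      rw [add_assoc]
    have : a * b - algebraMap ℝ _ (ε (a * b)) =
        (a - algebraMap ℝ _ (ε a)) * (b - algebraMap ℝ _ (ε b))
        + ε a • (b - algebraMap ℝ _ (ε b)) + ε b • (a - algebraMap ℝ _ (ε a)) := by
      simp only [map_mul, Algebra.algebraMap_eq_smul_one, sub_mul, mul_sub, smul_mul_assoc,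
        mul_smul_comm, one_mul, mul_one, smul_sub, smul_smul]
      rw [mul_comm (ε b) (ε a)]
      abel
    rw [this]
    exact add_mem (add_mem h2 (Submodule.smul_mem _ _ hb)) (Submodule.smul_mem _ _ ha)
  | add a b ha hb =>
    have : a + b - algebraMap ℝ _ (ε (a + b)) =
        (a - algebraMap ℝ _ (ε a)) + (b - algebraMap ℝ _ (ε b)) := by
      rw [map_add, map_add]; abel
    rw [this]; exact add_mem ha hb

lemma K_pow_bot [FiniteDimensional ℝ W]
    (ε : ExteriorAlgebra ℝ W →ₐ[ℝ] ℝ) (hε : ∀ w : W, ε (ι ℝ w) = 0) :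
    K ε ^ (Module.finrank ℝ W + 1) = ⊥ := by
  have h1 : K ε ≤ J W 1 := fun x hx => by
    have := sub_eps_mem_J ε hε x
    rwa [mem_K.mp hx, map_zero, sub_zero] at this
  rw [eq_bot_iff]
  refine (pow_le_pow_left' h1 _).trans ((J_pow _).trans (iSup_le fun i => ?_))
  rw [piece_bot _ (by omega)]

lemma K_le (ε : ExteriorAlgebra ℝ W →ₐ[ℝ] ℝ) (hε : ∀ w : W, ε (ι ℝ w) = 0) :
    K ε ≤ LinearMap.range (ι ℝ) ⊔ K ε ^ 2 := by
  have key : ∀ x : ExteriorAlgebra ℝ W,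
      x - algebraMap ℝ _ (ε x) ∈ LinearMap.range (ι ℝ) ⊔ K ε ^ 2 := by
    intro x
    induction x using ExteriorAlgebra.induction with
    | algebraMap r => simp
    | ι w =>
      rw [hε, map_zero, sub_zero]
      exact Submodule.mem_sup_left ⟨w, rfl⟩
    | mul a b ha hb =>
      have h2 : (a - algebraMap ℝ _ (ε a)) * (b - algebraMap ℝ _ (ε b)) ∈
          LinearMap.range (ι ℝ) ⊔ K ε ^ 2 := by
        apply Submodule.mem_sup_right
        rw [pow_two]
        apply Submodule.mul_mem_mul <;> simp [mem_K]
      have : a * b - algebraMap ℝ _ (ε (a * b)) =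
          (a - algebraMap ℝ _ (ε a)) * (b - algebraMap ℝ _ (ε b))
          + ε a • (b - algebraMap ℝ _ (ε b)) + ε b • (a - algebraMap ℝ _ (ε a)) := by
        simp only [map_mul, Algebra.algebraMap_eq_smul_one, sub_mul, mul_sub, smul_mul_assoc,
          mul_smul_comm, one_mul, mul_one, smul_sub, smul_smul]
        rw [mul_comm (ε b) (ε a)]
        abel
      rw [this]
      exact add_mem (add_mem h2 (Submodule.smul_mem _ _ hb)) (Submodule.smul_mem _ _ ha)
    | add a b ha hb =>
      have : a + b - algebraMap ℝ _ (ε (a + b)) =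
          (a - algebraMap ℝ _ (ε a)) + (b - algebraMap ℝ _ (ε b)) := by
        rw [map_add, map_add]; abel
      rw [this]; exact add_mem ha hb
  intro x hx
  have := key x
  rwa [mem_K.mp hx, map_zero, sub_zero] at this

lemma isUnit_of_eps [FiniteDimensional ℝ W]
    (ε : ExteriorAlgebra ℝ W →ₐ[ℝ] ℝ) (hε : ∀ w : W, ε (ι ℝ w) = 0)
    (u : ExteriorAlgebra ℝ W) (hu : ε u = 1) : IsUnit u := by
  have h : u - 1 ∈ K ε := by simp [mem_K, hu]
  have : IsNilpotent (u - 1) := by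
    refine ⟨Module.finrank ℝ W + 1, ?_⟩
    have := Submodule.pow_mem_pow _ h (Module.finrank ℝ W + 1)
    rwa [K_pow_bot ε hε, Submodule.mem_bot] at this
  simpa using this.isUnit_add_one

lemma K_sq_le (ε : ExteriorAlgebra ℝ W →ₐ[ℝ] ℝ) {x} (hx : x ∈ K ε ^ 2) :
    x ∈ (RingHom.ker ε) ^ 2 := by
  rw [pow_two] at hx
  rw [Submodule.pow_succ, Submodule.pow_one]
  induction hx using Submodule.mul_induction_on' with
  | mem_mul_mem a ha b hb => exact Ideal.mul_mem_mul ha hb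
  | add x _ y _ hx hy => exact add_mem hx hy

lemma K_sq_le_K (ε : ExteriorAlgebra ℝ W →ₐ[ℝ] ℝ) : K ε ^ 2 ≤ K ε := by
  rw [pow_two, Submodule.mul_le]
  intro a ha b hb
  rw [mem_K] at *
  simp [ha]

/-- A bijectivity criterion. -/
lemma bij_of [FiniteDimensional ℝ W]
    (ε : ExteriorAlgebra ℝ W →ₐ[ℝ] ℝ) (hε : ∀ w : W, ε (ι ℝ w) = 0)
    (G : ExteriorAlgebra ℝ W →ₐ[ℝ] ExteriorAlgebra ℝ W)
    (hG : ∀ w, G (ι ℝ w) - ι ℝ w ∈ K ε ^ 2) : Function.Bijective G := by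
  have hεG : ∀ x, ε (G x) = ε x := by
    have : ε.comp G = ε := by
      apply ExteriorAlgebra.hom_ext
      ext w
      have := mem_K.mp (K_sq_le_K ε (hG w))
      rw [map_sub, sub_eq_zero] at this
      simpa using this
    exact fun x => DFunLike.congr_fun this x
  have hGK : ∀ x ∈ K ε, G x ∈ K ε := fun x hx => by rw [mem_K, hεG]; exact hx
  have split : ∀ a b, G (a * b) - a * b = (G a - a) * G b + a * (G b - b) := by
    intro a b; rw [map_mul, sub_mul, mul_sub]; abel
  have hGp : ∀ k, ∀ x ∈ K ε ^ k, G x ∈ K ε ^ k := by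
    intro k x hx
    have h1 : Submodule.map G.toLinearMap (K ε) ≤ K ε := by
      rintro _ ⟨y, hy, rfl⟩; exact hGK y hy
    have : Submodule.map G.toLinearMap (K ε ^ k) ≤ K ε ^ k := by
      rw [Submodule.map_pow]; exact pow_le_pow_left' h1 k
    exact this ⟨x, hx, rfl⟩
  have hsub : ∀ x, G x - x ∈ K ε := fun x => by rw [mem_K, map_sub, hεG, sub_self]
  have hK1 : ∀ x ∈ K ε, G x - x ∈ K ε ^ 2 := by
    intro x hx
    obtain ⟨y, ⟨w, rfl⟩, z, hz, rfl⟩ := Submodule.mem_sup.mp (K_le ε hε hx)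
    rw [map_add, add_sub_add_comm]
    exact add_mem (hG w) (sub_mem (hGp 2 z hz) hz)
  have hKk : ∀ k, ∀ x ∈ K ε ^ k, G x - x ∈ K ε ^ (k + 1) := by
    intro k
    induction k with
    | zero =>
      intro x hx
      rw [pow_zero, Submodule.mem_one] at hx
      obtain ⟨r, rfl⟩ := hx
      simp
    | succ k ih =>
      intro x hx
      rw [pow_succ'] at hx
      induction hx using Submodule.mul_induction_on' with
      | mem_mul_mem a ha b hb =>
        rw [split]
        apply add_mem
        · have := Submodule.mul_mem_mul (hK1 a ha) (hGp k b hb)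
          rwa [← pow_add, show 2 + k = k + 1 + 1 by omega] at this
        · rw [pow_succ']
          exact Submodule.mul_mem_mul ha (ih b hb)
      | add x _ y _ hx hy =>
        rw [map_add, add_sub_add_comm]; exact add_mem hx hy
  have hN : ∀ k, ∀ x, ((G.toLinearMap - 1 : Module.End ℝ (ExteriorAlgebra ℝ W)) ^ (k + 1)) x
      ∈ K ε ^ (k + 1) := by
    intro k
    induction k with
    | zero => intro x; simpa using hsub x
    | succ k ih =>
      intro x
      rw [pow_succ' (G.toLinearMap - 1 : Module.End ℝ (ExteriorAlgebra ℝ W)), Module.End.mul_apply]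
      exact hKk _ _ (ih x)
  have hnil : IsNilpotent (G.toLinearMap - 1 : Module.End ℝ (ExteriorAlgebra ℝ W)) := by
    refine ⟨Module.finrank ℝ W + 1, ?_⟩
    refine LinearMap.ext fun x => ?_
    have := hN (Module.finrank ℝ W) x
    rw [K_pow_bot ε hε, Submodule.mem_bot] at this
    rw [this]; rfl
  have := hnil.isUnit_add_one
  rw [sub_add_cancel, Module.End.isUnit_iff] at this
  exact this

section SD

variable {ε : ExteriorAlgebra ℝ W →ₐ[ℝ] ℝ} 
  {D : ExteriorAlgebra ℝ W →ₗ[ℝ] ExteriorAlgebra ℝ W}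

lemma leib (hD : ∀ (k : ℕ) (a b : ExteriorAlgebra ℝ W), a ∈ piece W k →
      D (a * b) = D a * b + ((-1 : ℝ) ^ k) • (a * D b)) (a : ExteriorAlgebra ℝ W) :
    ∀ b, D (a * b) = D a * b + tau W a * D b := by
  induction a using ExteriorAlgebra.induction with
  | algebraMap r =>
    intro b
    have := hD 0 (algebraMap ℝ _ r) b (by simp [piece, Submodule.mem_one])
    simpa using this
  | ι w =>
    intro b
    have := hD 1 (ι ℝ w) b (by simp [piece])
    rw [this, tau_ι]; simp
  | mul a b ha hb =>
    intro c
    rw [mul_assoc, ha, hb, ha, map_mul, mul_add, add_mul]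
    simp only [mul_assoc, add_assoc]
  | add a b ha hb =>
    intro c
    rw [add_mul, map_add, ha, hb, map_add, map_add, add_mul, add_mul]; abel

lemma D_one (hD : ∀ a b, D (a * b) = D a * b + tau W a * D b) : D 1 = 0 := by
  have := hD 1 1
  simpa using this

lemma D_alg (hD : ∀ a b, D (a * b) = D a * b + tau W a * D b) (r : ℝ) :
    D (algebraMap ℝ _ r) = 0 := by
  rw [Algebra.algebraMap_eq_smul_one, map_smul, D_one hD, smul_zero]

lemma eps_tau (hε : ∀ w : W, ε (ι ℝ w) = 0) (x) : ε (tau W x) = ε x := by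
  have : ε.comp (tau W) = ε := by
    apply ExteriorAlgebra.hom_ext
    ext w
    simp [tau_ι, hε]
  exact DFunLike.congr_fun this x

lemma D_K_sq (hε : ∀ w : W, ε (ι ℝ w) = 0)
    (hD : ∀ a b, D (a * b) = D a * b + tau W a * D b) {x} (hx : x ∈ K ε ^ 2) :
    ε (D x) = 0 := by
  rw [pow_two] at hx
  induction hx using Submodule.mul_induction_on' with
  | mem_mul_mem a ha b hb =>
    rw [mem_K] at ha hb
    rw [hD, map_add, map_mul, map_mul, eps_tau hε, ha, hb]; simp
  | add x _ y _ hx hy => rw [map_add, map_add, hx, hy, add_zero]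

end SD

/-- The inductive construction of the linear part of the automorphism. -/
lemma exists_g [FiniteDimensional ℝ W] {Idx : Type*} [DecidableEq Idx]
    (ε : ExteriorAlgebra ℝ W →ₐ[ℝ] ℝ) (hε : ∀ w : W, ε (ι ℝ w) = 0)
    (D : Idx → ExteriorAlgebra ℝ W →ₗ[ℝ] ExteriorAlgebra ℝ W)
    (hD : ∀ i a b, D i (a * b) = D i a * b + tau W a * D i b)
    (hodd : ∀ i x, tau W x = -x → tau W (D i x) = D i x)
    (q : Idx → Module.Dual ℝ W) (hq : ∀ i w, q i w = ε (D i (ι ℝ w)))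
    (wd : Idx → W) (hwd : ∀ i k, q i (wd k) = if i = k then 1 else 0)
    (hanti : ∀ i j x, D i (D j x) = - D j (D i x)) (s : Finset Idx) :
    ∃ g : W →ₗ[ℝ] ExteriorAlgebra ℝ W, (∀ w, tau W (g w) = - g w) ∧
      (∀ w, g w - ι ℝ w ∈ K ε ^ 2) ∧ ∀ i ∈ s, ∀ w, D i (g w) = algebraMap ℝ _ (q i w) := by
  induction s using Finset.induction_on with
  | empty => exact ⟨ι ℝ, fun w => tau_ι w, fun w => by simp, by simp⟩
  | insert k s hk ih =>
    obtain ⟨g, hg1, hg2, hg3⟩ := ih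
    have heD : ∀ i w, ε (D i (g w)) = q i w := by
      intro i w
      have := D_K_sq hε (hD i) (hg2 w)
      rw [map_sub, map_sub, sub_eq_zero] at this
      rw [this, hq]
    have heg : ∀ w, g w ∈ K ε := by
      intro w
      have := K_sq_le_K ε (hg2 w)
      rw [mem_K, map_sub, hε, sub_zero] at this
      exact this
    have hDD : ∀ i x, D i (D i x) = 0 := fun i x => self_eq_neg' (hanti i i x)
    set y := g (wd k) with hy
    have hDy : ∀ i ∈ s, D i y = 0 := by
      intro i hi
      rw [hg3 i hi, hwd, if_neg (fun h : i = k => hk (h ▸ hi)), map_zero]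
    have hu : IsUnit (D k y) := isUnit_of_eps ε hε _ (by rw [heD, hwd, if_pos rfl])
    obtain ⟨u, hu⟩ := hu
    have htu : tau W (u : ExteriorAlgebra ℝ W) = u := by
      rw [hu]; exact hodd k y (hg1 _)
    set v : ExteriorAlgebra ℝ W := ((u⁻¹ : (ExteriorAlgebra ℝ W)ˣ) : ExteriorAlgebra ℝ W) with hv
    have huv : (u : ExteriorAlgebra ℝ W) * v = 1 := u.mul_inv
    have hvu : v * (u : ExteriorAlgebra ℝ W) = 1 := u.inv_mul
    have htv : tau W v = v := by
      have h := congrArg (tau W) huv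
      rw [map_mul, htu, map_one] at h
      calc tau W v = (v * u) * tau W v := by rw [hvu, one_mul]
        _ = v := by rw [mul_assoc, h, mul_one]
    have hDu : ∀ i ∈ insert k s, D i (u : ExteriorAlgebra ℝ W) = 0 := by
      intro i hi
      rw [hu]
      rcases Finset.mem_insert.mp hi with rfl | hi
      · exact hDD _ _
      · rw [hanti, hDy i hi, map_zero, neg_zero]
    have hDv : ∀ i ∈ insert k s, D i v = 0 := by
      intro i hi
      have h := congrArg (D i) huv
      rw [hD, hDu i hi, htu, D_one (hD i), zero_mul, zero_add] at h
      calc D i v = (v * u) * D i v := by rw [hvu, one_mul]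
        _ = 0 := by rw [mul_assoc, h, mul_zero]
    set x := y * v with hx
    have hxt : tau W x = - x := by rw [hx, map_mul, htv, hg1, neg_mul]
    have hxK : x ∈ K ε := by rw [mem_K, hx, map_mul, mem_K.mp (heg _), zero_mul]
    have hDxk : D k x = 1 := by
      rw [hx, hD, hDv k (Finset.mem_insert_self _ _), mul_zero, add_zero, ← hu, huv]
    have hDxi : ∀ i ∈ s, D i x = 0 := by
      intro i hi
      rw [hx, hD, hDv i (Finset.mem_insert_of_mem hi), hDy i hi, mul_zero, zero_mul, add_zero]
    refine ⟨g - LinearMap.mulLeft ℝ x ∘ₗ (D k ∘ₗ g - Algebra.linearMap ℝ _ ∘ₗ q k), ?_, ?_, ?_⟩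
    · intro w
      simp only [LinearMap.sub_apply, LinearMap.comp_apply, LinearMap.mulLeft_apply,
        Algebra.linearMap_apply, map_sub, map_mul, AlgHom.commutes]
      rw [hg1, hxt, hodd k _ (hg1 w)]
      simp only [mul_sub, neg_mul]
      abel
    · intro w
      simp only [LinearMap.sub_apply, LinearMap.comp_apply, LinearMap.mulLeft_apply,
        Algebra.linearMap_apply]
      rw [sub_right_comm]
      refine sub_mem (hg2 w) ?_
      rw [pow_two]
      refine Submodule.mul_mem_mul hxK ?_
      rw [mem_K, map_sub, heD]
      simp
    · intro i hi w
      simp only [LinearMap.sub_apply, LinearMap.comp_apply, LinearMap.mulLeft_apply,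
        Algebra.linearMap_apply]
      rw [map_sub, hD, map_sub (D i), D_alg (hD i), sub_zero, hxt]
      rcases Finset.mem_insert.mp hi with rfl | hi
      · rw [hDxk, hDD]; simp
      · rw [hDxi i hi, hanti, hg3 i hi, D_alg (hD k)]; simp

end Stmt6Aux

/-- given a linear family `v ↦ D_v` of pairwise anticommuting odd
superderivations of `ΛW` such that `v ↦ p_{D_v}`, with `p_{D_v}(w) = ε(D_v(ι w))`, is
injective, there is a parity-preserving unital algebra automorphism `G` of `ΛW` with
`G(ι w) − ι w ∈ (ker ε)²` and `D_v ∘ G = G ∘ ι_{p_{D_v}}`.  Here `ε` is the augmentation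
and `c α` the contraction by `α`, each characterized by the stated axioms. -/
theorem stmt6 (V W : Type*) [AddCommGroup V] [Module ℝ V]
    [AddCommGroup W] [Module ℝ W] [FiniteDimensional ℝ W]
    (ε : ExteriorAlgebra ℝ W →ₐ[ℝ] ℝ)
    (hε : ∀ w : W, ε (ExteriorAlgebra.ι ℝ w) = 0)
    (c : Module.Dual ℝ W → ExteriorAlgebra ℝ W →ₗ[ℝ] ExteriorAlgebra ℝ W)
    (hc1 : ∀ α, c α 1 = 0)
    (hc2 : ∀ α (w : W), c α (ExteriorAlgebra.ι ℝ w) = algebraMap ℝ _ (α w))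
    (hc3 : ∀ α (k : ℕ) (x y : ExteriorAlgebra ℝ W), x ∈ piece W k →
      c α (x * y) = c α x * y + ((-1 : ℝ) ^ k) • (x * c α y))
    (Dmap : V →ₗ[ℝ] (ExteriorAlgebra ℝ W →ₗ[ℝ] ExteriorAlgebra ℝ W))
    (hDeven : ∀ v : V, ∀ x ∈ evenPart W, Dmap v x ∈ oddPart W)
    (hDodd : ∀ v : V, ∀ x ∈ oddPart W, Dmap v x ∈ evenPart W)
    (hDleib : ∀ v : V, ∀ (k : ℕ) (a b : ExteriorAlgebra ℝ W), a ∈ piece W k →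
      Dmap v (a * b) = Dmap v a * b + ((-1 : ℝ) ^ k) • (a * Dmap v b))
    (p : V → Module.Dual ℝ W)
    (hp : ∀ (v : V) (w : W), p v w = ε (Dmap v (ExteriorAlgebra.ι ℝ w)))
    (hinj : Function.Injective p)
    (hanti : ∀ v v' : V, Dmap v ∘ₗ Dmap v' + Dmap v' ∘ₗ Dmap v = 0) :
    ∃ G : ExteriorAlgebra ℝ W ≃ₐ[ℝ] ExteriorAlgebra ℝ W,
      Submodule.map G.toLinearMap (evenPart W) = evenPart W ∧
      Submodule.map G.toLinearMap (oddPart W) = oddPart W ∧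
      (∀ w : W, G (ExteriorAlgebra.ι ℝ w) - ExteriorAlgebra.ι ℝ w ∈ (RingHom.ker ε) ^ 2) ∧
      (∀ (v : V) (σ : ExteriorAlgebra ℝ W), Dmap v (G σ) = G (c (p v) σ)) := by
  classical
  have hL : ∀ v a b, Dmap v (a * b) = Dmap v a * b + Stmt6Aux.tau W a * Dmap v b :=
    fun v a => Stmt6Aux.leib (hDleib v) a
  have hLc : ∀ α a b, c α (a * b) = c α a * b + Stmt6Aux.tau W a * c α b :=
    fun α a => Stmt6Aux.leib (hc3 α) a
  let pl : V →ₗ[ℝ] Module.Dual ℝ W :=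
    { toFun := p
      map_add' := fun a b => by ext w; simp [hp]
      map_smul' := fun r a => by ext w; simp [hp] }
  have hpl : ∀ v, pl v = p v := fun _ => rfl
  have hplinj : Function.Injective pl := hinj
  haveI : FiniteDimensional ℝ V := FiniteDimensional.of_injective pl hplinj
  let b := Module.finBasis ℝ V
  have hsurj : ∀ φ : Module.Dual ℝ V, ∃ w : W, ∀ v, p v w = φ v := by
    intro φ
    obtain ⟨ψ, hψ⟩ := LinearMap.dualMap_surjective_iff.mpr hplinj φ
    obtain ⟨w, rfl⟩ := (Module.evalEquiv ℝ W).surjective ψ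
    exact ⟨w, fun v => by rw [← hψ]; rfl⟩
  choose wd hwd using fun k => hsurj (b.coord k)
  obtain ⟨g, hg1, hg2, hg3⟩ := Stmt6Aux.exists_g ε hε (fun i => Dmap (b i)) (fun i => hL (b i))
    (fun i x hx => Stmt6Aux.tau_of_even (hDodd _ _ (Stmt6Aux.mem_odd_iff.mpr hx)))
    (fun i => p (b i)) (fun i w => hp _ _) wd
    (fun i k => by rw [hwd]; simp [Finsupp.single_apply])
    (fun i j x => by
      have := LinearMap.congr_fun (hanti (b i) (b j)) x
      exact eq_neg_of_add_eq_zero_left this) Finset.univ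
  have hg4 : ∀ v w, Dmap v (g w) = algebraMap ℝ _ (p v w) := by
    intro v w
    have : (LinearMap.flip Dmap (g w)) =
        Algebra.linearMap ℝ (ExteriorAlgebra ℝ W) ∘ₗ LinearMap.flip pl w := by
      apply b.ext
      intro i
      exact hg3 i (Finset.mem_univ i) w
    exact LinearMap.congr_fun this v
  let G₀ : ExteriorAlgebra ℝ W →ₐ[ℝ] ExteriorAlgebra ℝ W :=
    ExteriorAlgebra.lift ℝ ⟨g, fun w => Stmt6Aux.odd_sq (hg1 w)⟩
  have hGι : ∀ w, G₀ (ExteriorAlgebra.ι ℝ w) = g w := fun w => by simp [G₀]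
  have hbij : Function.Bijective G₀ :=
    Stmt6Aux.bij_of ε hε G₀ (fun w => by rw [hGι]; exact hg2 w)
  have hGtau : ∀ x, Stmt6Aux.tau W (G₀ x) = G₀ (Stmt6Aux.tau W x) := by
    have : (Stmt6Aux.tau W).comp G₀ = G₀.comp (Stmt6Aux.tau W) := by
      apply ExteriorAlgebra.hom_ext
      ext w
      simp [hGι, hg1, Stmt6Aux.tau_ι]
    exact fun x => DFunLike.congr_fun this x
  let G := AlgEquiv.ofBijective G₀ hbij
  have hG : ∀ x, G x = G₀ x := fun _ => rfl
  refine ⟨G, ?_, ?_, ?_, ?_⟩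
  · ext x
    constructor
    · rintro ⟨y, hy, rfl⟩
      change G₀ y ∈ _
      rw [Stmt6Aux.mem_even_iff, hGtau, Stmt6Aux.tau_of_even hy]
    · intro hx
      obtain ⟨y, rfl⟩ := hbij.2 x
      refine ⟨y, ?_, rfl⟩
      have := Stmt6Aux.tau_of_even hx
      rw [hGtau] at this
      exact Stmt6Aux.mem_even_iff.mpr (hbij.1 this)
  · ext x
    constructor
    · rintro ⟨y, hy, rfl⟩
      change G₀ y ∈ _
      rw [Stmt6Aux.mem_odd_iff, hGtau, Stmt6Aux.tau_of_odd hy, map_neg]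
    · intro hx
      obtain ⟨y, rfl⟩ := hbij.2 x
      refine ⟨y, ?_, rfl⟩
      have := Stmt6Aux.tau_of_odd hx
      rw [hGtau, ← map_neg] at this
      exact Stmt6Aux.mem_odd_iff.mpr (hbij.1 this)
  · intro w
    rw [hG, hGι]
    exact Stmt6Aux.K_sq_le ε (hg2 w)
  · intro v σ
    rw [hG, hG]
    induction σ using ExteriorAlgebra.induction with
    | algebraMap r =>
      rw [AlgHom.commutes, Stmt6Aux.D_alg (hL v), Stmt6Aux.D_alg (hLc _), map_zero]
    | ι w => rw [hGι, hg4, hc2, AlgHom.commutes]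
    | mul a b ha hb =>
      rw [map_mul, hL, ha, hb, hLc, map_add, map_mul, map_mul, hGtau]
    | add a b ha hb => rw [map_add, map_add, ha, hb, map_add, map_add]
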